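/- Let K ≥ 2 and let W₁,…,W_K, Y₁,…,Y_K, S be random variables on a common probability space taking values in finite measurable types, and let ε ≥ 0. Assume: (i) H(W_i | (Y_i, S)) ≤ ε for every i ∈ {1,…,K}; (ii) I(W_i ; (Y₁,…,Y_{i−1}) | S) ≤ ε for every i ∈ {2,…,K}; (iii) I(W_K ; W₁ | S) = 0. Then Σ_{i=1}^{K} H(W_i | S) ≤ Σ_{i=1}^{K−1} [ H(Y_i | (Y₁,…,Y_{i−1}, S)) − H(Y_i | (Y₁,…,Y_{i−1}, W_i, S)) ] + H(Y_K | (Y₁,…,Y_{K−1}, W₁, S)) − H(Y_K | (Y₁,…,Y_{K−1}, W₁, W_K, S)) + 2Kε. -/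

import Mathlib

open MeasureTheory

namespace Paper

variable {Ω : Type*} [MeasurableSpace Ω]

/-- Shannon entropy of a finitely-valued random variable. -/
noncomputable def entH {S : Type*} [Fintype S] [MeasurableSpace S]
    (μ : Measure Ω) (X : Ω → S) : ℝ :=
  ∑ s : S, Real.negMulLog ((μ.map X) {s}).toReal

/-- Conditional Shannon entropy `H(X | Y)`. -/
noncomputable def condH {S T : Type*} [Fintype S] [MeasurableSpace S]
    [Fintype T] [MeasurableSpace T] (μ : Measure Ω) (X : Ω → S) (Y : Ω → T) : ℝ :=
  entH μ (fun ω => (X ω, Y ω)) - entH μ Y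

/-- Mutual information `I(X ; Y)`. -/
noncomputable def mutI {S T : Type*} [Fintype S] [MeasurableSpace S]
    [Fintype T] [MeasurableSpace T] (μ : Measure Ω) (X : Ω → S) (Y : Ω → T) : ℝ :=
  entH μ X + entH μ Y - entH μ (fun ω => (X ω, Y ω))

/-- Conditional mutual information `I(X ; Y | Z)`. -/
noncomputable def condI {S T U : Type*} [Fintype S] [MeasurableSpace S]
    [Fintype T] [MeasurableSpace T] [Fintype U] [MeasurableSpace U]
    (μ : Measure Ω) (X : Ω → S) (Y : Ω → T) (Z : Ω → U) : ℝ :=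
  condH μ X Z + condH μ Y Z - condH μ (fun ω => (X ω, Y ω)) Z

/-- The tuple `(Y 0, …, Y (m-1))` of the first `m` random variables of a family `Y`. -/
def preY {Ω : Type*} {n : ℕ} {β : Fin n → Type*} (Y : ∀ i, Ω → β i) (m : ℕ) (hm : m ≤ n)
    (ω : Ω) : ∀ s : Fin m, β (Fin.castLE hm s) :=
  fun s => Y (Fin.castLE hm s) ω

section Entropy

open Finset

open Classical in
theorem map_comp_singleton_toReal {μ : Measure Ω} [IsFiniteMeasure μ] {A B : Type*}
    [Fintype A] [MeasurableSpace A] [MeasurableSingletonClass A] [MeasurableSpace B]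
    [MeasurableSingletonClass B]
    {X : Ω → A} (hX : Measurable X) (f : A → B) (b : B) :
    ((μ.map (fun ω => f (X ω))) {b}).toReal =
      ∑ a with f a = b, ((μ.map X) {a}).toReal := by
  have hf : Measurable f := measurable_of_finite f
  have h : μ.map (fun ω => f (X ω)) = (μ.map X).map f := (Measure.map_map hf hX).symm
  have hset : f ⁻¹' {b} = ↑({a | f a = b} : Finset A) := by ext a; simp
  rw [h, Measure.map_apply hf (measurableSet_singleton b), hset]
  exact (sum_measureReal_singleton _).symm

theorem map_singleton_le_map_comp {μ : Measure Ω} [IsFiniteMeasure μ] {A B : Type*}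
    [Fintype A] [MeasurableSpace A] [MeasurableSingletonClass A] [MeasurableSpace B]
    [MeasurableSingletonClass B]
    {X : Ω → A} (hX : Measurable X) (f : A → B) (a : A) :
    ((μ.map X) {a}).toReal ≤ ((μ.map (fun ω => f (X ω))) {f a}).toReal := by
  classical
  rw [map_comp_singleton_toReal hX f (f a)]
  exact single_le_sum (f := fun a => ((μ.map X) {a}).toReal)
    (fun _ _ => ENNReal.toReal_nonneg) (by simp)

variable {μ : Measure Ω} {A B C D : Type*}
  [Fintype A] [MeasurableSpace A] [MeasurableSingletonClass A]
  [Fintype B] [MeasurableSpace B] [MeasurableSingletonClass B]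
  [Fintype C] [MeasurableSpace C] [MeasurableSingletonClass C]
  [Fintype D] [MeasurableSpace D] [MeasurableSingletonClass D]

/-- The entropy of a function of `X` is the expected surprisal summed over the values of `X`. -/
theorem entH_comp_eq_sum [IsFiniteMeasure μ] {X : Ω → A} (hX : Measurable X) (f : A → B) :
    entH μ (fun ω => f (X ω)) =
      ∑ a, -(((μ.map X) {a}).toReal *
        Real.log ((μ.map (fun ω => f (X ω))) {f a}).toReal) := by
  classical
  rw [entH, ← sum_fiberwise univ f]
  refine sum_congr rfl fun b _ => ?_
  rw [Real.negMulLog, map_comp_singleton_toReal hX f b, neg_mul, sum_mul, ← sum_neg_distrib]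
  refine sum_congr rfl fun a ha => ?_
  rw [← map_comp_singleton_toReal hX f b, (mem_filter.1 ha).2]

theorem entH_comp_le [IsFiniteMeasure μ] {X : Ω → A} (hX : Measurable X) (f : A → B) :
    entH μ (fun ω => f (X ω)) ≤ entH μ X := by
  rw [entH_comp_eq_sum hX f, entH]
  refine sum_le_sum fun a _ => ?_
  rw [Real.negMulLog, neg_mul, neg_le_neg_iff]
  rcases (ENNReal.toReal_nonneg (a := (μ.map X) {a})).eq_or_lt with h | h
  · simp [← h]
  · exact mul_le_mul_of_nonneg_left (Real.log_le_log h (map_singleton_le_map_comp hX f a)) h.le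

theorem entH_eq_of_comp [IsFiniteMeasure μ] {X : Ω → A} {Y : Ω → B} (hX : Measurable X)
    (f : A → B) (g : B → A) (hf : ∀ ω, f (X ω) = Y ω) (hg : ∀ ω, g (Y ω) = X ω) :
    entH μ X = entH μ Y := by
  obtain rfl : (fun ω => f (X ω)) = Y := funext hf
  have h := entH_comp_le (μ := μ) ((measurable_of_finite f).comp hX) g
  simp only [Function.comp_apply, hg] at h
  exact le_antisymm h (entH_comp_le hX f)

theorem sub_le_mul_log_combination {p u v w : ℝ} (hp : 0 ≤ p) (hpu : p ≤ u) (hpv : p ≤ v)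
    (hpw : p ≤ w) :
    p - u * v / w ≤ p * Real.log p + p * Real.log w - p * Real.log u - p * Real.log v := by
  rcases hp.eq_or_lt with rfl | h
  · simp only [zero_mul, zero_sub, sub_zero, add_zero]
    exact neg_nonpos.2 (div_nonneg (mul_nonneg hpu hpv) hpw)
  · have hu := h.trans_le hpu
    have hv := h.trans_le hpv
    have hw := h.trans_le hpw
    have key := Real.log_le_sub_one_of_pos (x := u * v / (w * p)) (by positivity)
    rw [Real.log_div (by positivity) (by positivity), Real.log_mul hu.ne' hv.ne',
      Real.log_mul hw.ne' h.ne'] at key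
    have := mul_le_mul_of_nonneg_left key hp
    have e : p * (u * v / (w * p) - 1) = u * v / w - p := by field_simp
    rw [e] at this
    linarith

theorem sum_map_fst_singleton [IsFiniteMeasure μ] {X : Ω → A} {Z : Ω → C} (hX : Measurable X)
    (hZ : Measurable Z) (c : C) :
    ∑ a, ((μ.map (fun ω => (X ω, Z ω))) {(a, c)}).toReal = ((μ.map Z) {c}).toReal := by
  classical
  rw [map_comp_singleton_toReal (hX.prodMk hZ) Prod.snd c, sum_filter, Fintype.sum_prod_type]
  simp

/-- Submodularity of Shannon entropy. -/
theorem entH_submodular [IsFiniteMeasure μ] {X : Ω → A} {Y : Ω → B} {Z : Ω → C}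
    (hX : Measurable X) (hY : Measurable Y) (hZ : Measurable Z) :
    entH μ (fun ω => (X ω, Y ω, Z ω)) + entH μ Z ≤
      entH μ (fun ω => (X ω, Z ω)) + entH μ (fun ω => (Y ω, Z ω)) := by
  have hT : Measurable fun ω => (X ω, Y ω, Z ω) := hX.prodMk (hY.prodMk hZ)
  have eXZ := entH_comp_eq_sum (μ := μ) hT (fun t => (t.1, t.2.2))
  have eYZ := entH_comp_eq_sum (μ := μ) hT (fun t => t.2)
  have eZ := entH_comp_eq_sum (μ := μ) hT (fun t => t.2.2)
  have eT := entH_comp_eq_sum (μ := μ) hT (fun t => t)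
  have hpt := sum_le_sum fun t (_ : t ∈ univ) => sub_le_mul_log_combination
    (ENNReal.toReal_nonneg (a := (μ.map (fun ω => (X ω, Y ω, Z ω))) {t}))
    (map_singleton_le_map_comp hT (fun t => (t.1, t.2.2)) t)
    (map_singleton_le_map_comp hT (fun t => t.2) t)
    (map_singleton_le_map_comp hT (fun t => t.2.2) t)
  simp only [sum_sub_distrib, sum_add_distrib, sum_neg_distrib] at hpt eXZ eYZ eZ eT
  have hsum : ∑ t : A × B × C, ((μ.map (fun ω => (X ω, Y ω, Z ω))) {t}).toReal =
      ∑ t : A × B × C, ((μ.map (fun ω => (X ω, Z ω))) {(t.1, t.2.2)}).toReal *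
        ((μ.map (fun ω => (Y ω, Z ω))) {t.2}).toReal / ((μ.map Z) {t.2.2}).toReal := by
    rw [Fintype.sum_prod_type_right, Fintype.sum_prod_type_right,
      Fintype.sum_prod_type_right, Fintype.sum_prod_type_right]
    refine sum_congr rfl fun c _ => ?_
    simp only [sum_map_fst_singleton hX (hY.prodMk hZ), ← sum_div, ← sum_mul, ← mul_sum,
      sum_map_fst_singleton hX hZ, sum_map_fst_singleton hY hZ]
    exact (mul_self_div_self _).symm
  linarith

variable [IsFiniteMeasure μ] {W : Ω → A} {V : Ω → B} {Y : Ω → C} {S : Ω → D}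

/-- Decoding `W` from `(Y, S)` and leaking `I(W ; V | S)` to `V` bounds the rate of `W` by
`I(W ; Y | V, S)`, up to the decoding and leakage terms. -/
theorem condH_le_of_decode_of_leak (hW : Measurable W) (hV : Measurable V) (hY : Measurable Y)
    (hS : Measurable S) :
    condH μ W S ≤ condH μ Y (fun ω => (V ω, S ω)) - condH μ Y (fun ω => (V ω, W ω, S ω)) +
      condH μ W (fun ω => (Y ω, S ω)) + condI μ W V S := by
  have h := entH_submodular (μ := μ) hW hV (hY.prodMk hS)
  have e₁ : entH μ (fun ω => (V ω, Y ω, S ω)) = entH μ (fun ω => (Y ω, V ω, S ω)) :=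
    entH_eq_of_comp (by fun_prop) (fun t => (t.2.1, t.1, t.2.2)) (fun t => (t.2.1, t.1, t.2.2))
      (fun _ => rfl) (fun _ => rfl)
  have e₂ : entH μ (fun ω => (W ω, V ω, Y ω, S ω)) = entH μ (fun ω => (Y ω, V ω, W ω, S ω)) :=
    entH_eq_of_comp (by fun_prop) (fun t => (t.2.2.1, t.2.1, t.1, t.2.2.2))
      (fun t => (t.2.2.1, t.2.1, t.1, t.2.2.2)) (fun _ => rfl) (fun _ => rfl)
  have e₃ : entH μ (fun ω => ((W ω, V ω), S ω)) = entH μ (fun ω => (V ω, W ω, S ω)) :=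
    entH_eq_of_comp (by fun_prop) (fun t => (t.1.2, t.1.1, t.2))
      (fun t => ((t.2.1, t.1), t.2.2)) (fun _ => rfl) (fun _ => rfl)
  simp only [condI, condH]
  linarith

theorem condI_eq_zero_of_subsingleton [Unique B] (hW : Measurable W) (hV : Measurable V)
    (hS : Measurable S) : condI μ W V S = 0 := by
  have e₁ : entH μ (fun ω => (V ω, S ω)) = entH μ S :=
    entH_eq_of_comp (by fun_prop) (fun t => t.2) (fun s => (default, s))
      (fun _ => rfl) (fun _ => Prod.ext (Subsingleton.elim _ _) rfl)
  have e₂ : entH μ (fun ω => ((W ω, V ω), S ω)) = entH μ (fun ω => (W ω, S ω)) :=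
    entH_eq_of_comp (by fun_prop) (fun t => (t.1.1, t.2)) (fun t => ((t.1, default), t.2))
      (fun _ => rfl) (fun _ => Prod.ext (Prod.ext rfl (Subsingleton.elim _ _)) rfl)
  simp only [condI, condH]
  linarith

/-- Adjoining to `V` a variable `U` that can be decoded from a function of `V` and from `S`
increases the leakage by at most the decoding term. -/
theorem condI_prod_le {E F : Type*} [Fintype E] [MeasurableSpace E] [MeasurableSingletonClass E]
    [Fintype F] [MeasurableSpace F] [MeasurableSingletonClass F] {U : Ω → E} (g : B → F)
    (hW : Measurable W) (hV : Measurable V) (hU : Measurable U) (hS : Measurable S) :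
    condI μ W (fun ω => (V ω, U ω)) S ≤
      condI μ W V S + condH μ U (fun ω => (g (V ω), S ω)) := by
  have hg : Measurable g := measurable_of_finite g
  have h := entH_submodular (μ := μ) hU hV ((hg.comp hV).prodMk hS)
  simp only [Function.comp_apply] at h
  have e₁ : entH μ (fun ω => (U ω, V ω, g (V ω), S ω)) = entH μ (fun ω => ((V ω, U ω), S ω)) :=
    entH_eq_of_comp (by fun_prop) (fun t => ((t.2.1, t.1), t.2.2.2))
      (fun t => (t.1.2, t.1.1, g t.1.1, t.2)) (fun _ => rfl) (fun _ => rfl)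
  have e₂ : entH μ (fun ω => (V ω, g (V ω), S ω)) = entH μ (fun ω => (V ω, S ω)) :=
    entH_eq_of_comp (by fun_prop) (fun t => (t.1, t.2.2))
      (fun t => (t.1, g t.1, t.2)) (fun _ => rfl) (fun _ => rfl)
  have hle := entH_comp_le (μ := μ) (X := fun ω => ((W ω, V ω, U ω), S ω)) (by fun_prop)
    (fun t => ((t.1.1, t.1.2.1), t.2))
  simp only [condI, condH]
  linarith

/-- The bound of `condH_le_of_decode_of_leak` conditioned on a further variable `U` that can be
decoded from a function of `V` and from `S`. -/
theorem condH_le_of_decode_of_leak_prod {E F : Type*} [Fintype E] [MeasurableSpace E]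
    [MeasurableSingletonClass E] [Fintype F] [MeasurableSpace F] [MeasurableSingletonClass F]
    {U : Ω → E} (g : B → F) (hW : Measurable W) (hV : Measurable V) (hU : Measurable U)
    (hY : Measurable Y) (hS : Measurable S) :
    condH μ W S ≤ condH μ Y (fun ω => (V ω, U ω, S ω)) -
      condH μ Y (fun ω => (V ω, U ω, W ω, S ω)) + condH μ W (fun ω => (Y ω, S ω)) +
      (condI μ W V S + condH μ U (fun ω => (g (V ω), S ω))) := by
  have h := condH_le_of_decode_of_leak (μ := μ) hW (hV.prodMk hU) hY hS
  have hI := condI_prod_le (μ := μ) g hW hV hU hS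
  have e₁ : condH μ Y (fun ω => ((V ω, U ω), S ω)) = condH μ Y (fun ω => (V ω, U ω, S ω)) :=
    congrArg₂ (· - ·)
      (entH_eq_of_comp (by fun_prop) (fun t => (t.1, t.2.1.1, t.2.1.2, t.2.2))
        (fun t => (t.1, (t.2.1, t.2.2.1), t.2.2.2)) (fun _ => rfl) (fun _ => rfl))
      (entH_eq_of_comp (by fun_prop) (fun t => (t.1.1, t.1.2, t.2))
        (fun t => ((t.1, t.2.1), t.2.2)) (fun _ => rfl) (fun _ => rfl))
  have e₂ : condH μ Y (fun ω => ((V ω, U ω), W ω, S ω)) =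
      condH μ Y (fun ω => (V ω, U ω, W ω, S ω)) :=
    congrArg₂ (· - ·)
      (entH_eq_of_comp (by fun_prop) (fun t => (t.1, t.2.1.1, t.2.1.2, t.2.2))
        (fun t => (t.1, (t.2.1, t.2.2.1), t.2.2.2)) (fun _ => rfl) (fun _ => rfl))
      (entH_eq_of_comp (by fun_prop) (fun t => (t.1.1, t.1.2, t.2))
        (fun t => ((t.1, t.2.1), t.2.2)) (fun _ => rfl) (fun _ => rfl))
  linarith

end Entropy

theorem measurable_preY {n : ℕ} {β : Fin n → Type*} [∀ i, MeasurableSpace (β i)]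
    {Y : ∀ i, Ω → β i} (hY : ∀ i, Measurable (Y i)) (m : ℕ) (hm : m ≤ n) :
    Measurable (fun ω => preY Y m hm ω) :=
  measurable_pi_lambda _ fun s => hY (Fin.castLE hm s)

/-- Intermediate converse bound (step2)/(cvp1)–(cvp3) of the K-user converse.  Here user
`i ∈ {1,…,K}` of the paper is index `i-1 : Fin K`, so `W₁ = W ⟨0,_⟩` and `W_K = W ⟨K-1,_⟩`. -/
theorem stmt_7 {Ω : Type*} [MeasurableSpace Ω] (μ : Measure Ω) [IsProbabilityMeasure μ]
    {K : ℕ} (hK : 2 ≤ K) {α β : Fin K → Type*} {σ : Type*}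
    [∀ i, Fintype (α i)] [∀ i, Nonempty (α i)]
    [∀ i, MeasurableSpace (α i)] [∀ i, MeasurableSingletonClass (α i)]
    [∀ i, Fintype (β i)] [∀ i, Nonempty (β i)]
    [∀ i, MeasurableSpace (β i)] [∀ i, MeasurableSingletonClass (β i)]
    [Fintype σ] [Nonempty σ] [MeasurableSpace σ] [MeasurableSingletonClass σ]
    (W : ∀ i, Ω → α i) (Y : ∀ i, Ω → β i) (S : Ω → σ)
    (hW : ∀ i, Measurable (W i)) (hY : ∀ i, Measurable (Y i)) (hS : Measurable S)
    {ε : ℝ} (hε : 0 ≤ ε)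
    (hfano : ∀ i, condH μ (W i) (fun ω => (Y i ω, S ω)) ≤ ε)
    (hsec : ∀ i : Fin K, i ≠ ⟨0, by omega⟩ →
      condI μ (W i) (fun ω => preY Y i.val i.isLt.le ω) S ≤ ε)
    (hindep : condI μ (W ⟨K - 1, by omega⟩) (W ⟨0, by omega⟩) S = 0) :
    ∑ i : Fin K, condH μ (W i) S ≤
      (∑ i : Fin (K - 1),
        (let j : Fin K := Fin.castLE (by omega) i
         condH μ (Y j) (fun ω => (preY Y j.val j.isLt.le ω, S ω)) -
           condH μ (Y j) (fun ω => (preY Y j.val j.isLt.le ω, W j ω, S ω)))) +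
      (let k : Fin K := ⟨K - 1, by omega⟩
       condH μ (Y k) (fun ω => (preY Y k.val k.isLt.le ω, W ⟨0, by omega⟩ ω, S ω)) -
         condH μ (Y k)
           (fun ω => (preY Y k.val k.isLt.le ω, W ⟨0, by omega⟩ ω, W k ω, S ω))) +
      2 * K * ε := by
  obtain ⟨n, rfl⟩ : ∃ n, K = n + 2 := ⟨K - 2, by omega⟩
  have hfirst := condH_le_of_decode_of_leak (μ := μ) (hW 0) (measurable_preY hY 0 (Nat.zero_le _))
    (hY 0) hS
  have : Unique (∀ s : Fin 0, β (Fin.castLE (Nat.zero_le (n + 2)) s)) := Pi.uniqueOfIsEmpty _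
  rw [condI_eq_zero_of_subsingleton (hW 0) (measurable_preY hY 0 (Nat.zero_le _)) hS,
    add_zero] at hfirst
  have hmid := Finset.sum_le_sum fun (i : Fin n) (_ : i ∈ Finset.univ) =>
    (condH_le_of_decode_of_leak (μ := μ) (hW i.succ.castSucc)
      (measurable_preY hY i.succ.castSucc.val i.succ.castSucc.isLt.le)
      (hY i.succ.castSucc) hS).trans
      (add_le_add (add_le_add le_rfl (hfano i.succ.castSucc))
        (hsec i.succ.castSucc (Fin.ne_of_val_ne (Nat.succ_ne_zero i.val))))
  have hlast := condH_le_of_decode_of_leak_prod (μ := μ) (fun v => v ⟨0, Nat.succ_pos n⟩)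
    (hW (Fin.last (n + 1)))
    (measurable_preY hY (Fin.last (n + 1)).val (Fin.last (n + 1)).isLt.le) (hW 0)
    (hY (Fin.last (n + 1))) hS
  have hsec' := hsec (Fin.last (n + 1)) (Fin.ne_of_val_ne (Nat.succ_ne_zero n))
  have hf₀ := hfano 0
  have hfl := hfano (Fin.last (n + 1))
  rw [Fin.sum_univ_castSucc, Fin.sum_univ_succ]
  change _ ≤ (∑ i : Fin (n + 1), _) + _ + _
  rw [Fin.sum_univ_succ]
  simp only [Finset.sum_add_distrib, Finset.sum_const, Finset.card_univ, Fintype.card_fin,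
    nsmul_eq_mul] at hmid
  have hUdec : condH μ (W 0) (fun ω =>
      (preY Y (Fin.last (n + 1)).val (Fin.last (n + 1)).isLt.le ω ⟨0, Nat.succ_pos n⟩, S ω)) ≤ ε :=
    hf₀
  have hbound := add_le_add (add_le_add (hfirst.trans (add_le_add le_rfl hf₀)) hmid)
    (hlast.trans (add_le_add (add_le_add le_rfl hfl) (add_le_add hsec' hUdec)))
  have hcollect : ∀ a s l : ℝ, a + ε + (s + n * ε + n * ε) + (l + ε + (ε + ε)) =
      a + s + l + 2 * ((n + 2 : ℕ) : ℝ) * ε := by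
    intro a s l
    push_cast
    ring
  exact hbound.trans (le_of_eq (hcollect _ _ _))

end Paper
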